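/- arXiv:1108.5862 — 3 statements merged into one kernel-verified Lean document; each statement's English description precedes it below -/
import Mathlib

section
/- Let (R,m) be a Noetherian local ring (or standard graded K-algebra with graded maximal ideal m), M a finitely generated R-module and N a submodule of M (graded if R is graded). Let S = gr_m(R) with graded maximal ideal n, and let N* be the kernel of the natural epimorphism gr_m(M) → gr_m(M/N). Then the Artin-Rees number satisfies ρ(N,M) = max { k : (N*/n·N*)_k ≠ 0 }. -/
open Submodule IsLocalRing

section AssocGraded

variable {R : Type*} [CommRing R]

/-- The `k`-th step `m^k M` of the `m`-adic filtration of `M`. -/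
abbrev adicPiece (m : Ideal R) (M : Type*) [AddCommGroup M] [Module R M] (k : ℕ) :
    Submodule R M := m ^ k • (⊤ : Submodule R M)

/-- The `k`-th graded piece `m^k M / m^{k+1} M` of the associated graded module of `M`. -/
abbrev grPiece (m : Ideal R) (M : Type*) [AddCommGroup M] [Module R M] (k : ℕ) :=
  adicPiece m M k ⧸ ((adicPiece m M (k + 1)).comap (adicPiece m M k).subtype)

/-- The canonical projection `m^k M → m^k M / m^{k+1} M`. -/
abbrev grMk (m : Ideal R) (M : Type*) [AddCommGroup M] [Module R M] (k : ℕ) :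
    adicPiece m M k →ₗ[R] grPiece m M k :=
  ((adicPiece m M (k + 1)).comap (adicPiece m M k).subtype).mkQ

lemma adicPiece_map_le {M M' : Type*} [AddCommGroup M] [Module R M] [AddCommGroup M']
    [Module R M'] (m : Ideal R) (f : M →ₗ[R] M') (k : ℕ) :
    ∀ x ∈ adicPiece m M k, f x ∈ adicPiece m M' k := by
  intro x hx
  have h : (adicPiece m M k).map f ≤ adicPiece m M' k := by
    rw [Submodule.map_smul'']
    exact Submodule.smul_mono le_rfl le_top
  exact h (Submodule.mem_map_of_mem hx)

/-- The map `gr_k(M) → gr_k(M')` induced in degree `k` by an `R`-linear map `f : M → M'`. -/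
noncomputable def grMap {M M' : Type*} [AddCommGroup M] [Module R M] [AddCommGroup M']
    [Module R M'] (m : Ideal R) (f : M →ₗ[R] M') (k : ℕ) :
    grPiece m M k →ₗ[R] grPiece m M' k :=
  Submodule.mapQ _ _ (f.restrict (adicPiece_map_le m f k))
    (fun x hx => adicPiece_map_le m f (k + 1) x hx)

end AssocGraded

/-- The Artin–Rees number `ρ(N, P)` of a pair of submodules `N, P` of an `R`-module with
respect to an ideal `m`: the smallest `r` such that
`N ∩ m^i P = m^{i-r} (N ∩ m^r P)` for all `i ≥ r`.  (For `P = ⊤` this is the Artin–Rees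
number of the submodule `N` of the ambient module.) -/
noncomputable def artinReesNumber {R : Type*} [CommRing R] {M : Type*} [AddCommGroup M]
    [Module R M] (m : Ideal R) (N P : Submodule R M) : ℕ :=
  sInf {r : ℕ | ∀ i : ℕ, r ≤ i → N ⊓ m ^ i • P = m ^ (i - r) • (N ⊓ m ^ r • P)}

section ArtinRees

variable {R : Type*} [CommRing R] {M : Type*} [AddCommGroup M] [Module R M]

lemma adicPiece_inf_comap_mkQ (I : Ideal R) (N : Submodule R M) (k : ℕ) :
    adicPiece I M k ⊓ Submodule.comap N.mkQ (adicPiece I (M ⧸ N) (k + 1)) =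
      (N ⊓ adicPiece I M k) ⊔ adicPiece I M (k + 1) := by
  have hmap : adicPiece I (M ⧸ N) (k + 1) = (adicPiece I M (k + 1)).map N.mkQ := by
    rw [Submodule.map_smul'', Submodule.map_top, Submodule.range_mkQ]
  have hle : adicPiece I M (k + 1) ≤ adicPiece I M k :=
    Submodule.smul_mono_left (Ideal.pow_le_pow_right k.le_succ)
  rw [hmap, Submodule.comap_map_mkQ, sup_comm N, inf_comm, sup_inf_assoc_of_le N hle, sup_comm]

lemma pow_smul_inf_adicPiece_le (I : Ideal R) (N : Submodule R M) (j k : ℕ) :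
    I ^ j • (N ⊓ adicPiece I M k) ≤ N ⊓ adicPiece I M (j + k) := by
  refine le_inf (Submodule.smul_le_right.trans inf_le_left) ?_
  calc I ^ j • (N ⊓ adicPiece I M k) ≤ I ^ j • adicPiece I M k :=
        Submodule.smul_mono le_rfl inf_le_right
    _ = adicPiece I M (j + k) := by rw [← Submodule.mul_smul, ← pow_add]

/-- `(N*/n N*)_{k+1} = 0` iff `N ∩ I^{k+1} M ⊆ I (N ∩ I^k M) + I^{k+2} M`. -/
lemma initial_succ_le_iff (I : Ideal R) (N : Submodule R M) (k : ℕ) :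
    (adicPiece I M (k + 1) ⊓ Submodule.comap N.mkQ (adicPiece I (M ⧸ N) (k + 1 + 1)) ≤
      (⨆ j ∈ Finset.Icc 1 (k + 1), I ^ j • (adicPiece I M (k + 1 - j) ⊓
        Submodule.comap N.mkQ (adicPiece I (M ⧸ N) (k + 1 - j + 1)))) ⊔
          adicPiece I M (k + 1 + 1)) ↔
    N ⊓ adicPiece I M (k + 1) ≤ I • (N ⊓ adicPiece I M k) ⊔ adicPiece I M (k + 1 + 1) := by
  have hsum : (⨆ j ∈ Finset.Icc 1 (k + 1), I ^ j • (adicPiece I M (k + 1 - j) ⊓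
        Submodule.comap N.mkQ (adicPiece I (M ⧸ N) (k + 1 - j + 1)))) ⊔
          adicPiece I M (k + 1 + 1) =
      I • (N ⊓ adicPiece I M k) ⊔ adicPiece I M (k + 1 + 1) := by
    simp only [adicPiece_inf_comap_mkQ]
    refine le_antisymm (sup_le (iSup₂_le fun j hj => ?_) le_sup_right)
      (sup_le_sup_right ?_ _)
    · obtain ⟨h1, h2⟩ := Finset.mem_Icc.mp hj
      obtain ⟨i, rfl⟩ := Nat.exists_eq_add_of_le' h1
      rw [Submodule.smul_sup]
      refine sup_le_sup ?_ ?_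
      · rw [pow_succ', Submodule.mul_smul]
        refine Submodule.smul_mono le_rfl ((pow_smul_inf_adicPiece_le I N _ _).trans ?_)
        rw [show i + (k + 1 - (i + 1)) = k by omega]
      · rw [← Submodule.mul_smul, ← pow_add,
          show i + 1 + (k + 1 - (i + 1) + 1) = k + 1 + 1 by omega]
    · refine le_trans ?_ (le_iSup₂_of_le 1 (Finset.mem_Icc.mpr ⟨le_rfl, by omega⟩) le_rfl)
      rw [pow_one, Nat.add_sub_cancel]
      exact Submodule.smul_mono le_rfl le_sup_left
  rw [hsum, adicPiece_inf_comap_mkQ, sup_le_iff, and_iff_left le_sup_right]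

/-- The stability condition defining the Artin–Rees number may be checked one step at a time. -/
lemma forall_inf_pow_smul_eq_iff (I : Ideal R) (N : Submodule R M) (r : ℕ) :
    (∀ i, r ≤ i → N ⊓ adicPiece I M i = I ^ (i - r) • (N ⊓ adicPiece I M r)) ↔
      ∀ k, r ≤ k → N ⊓ adicPiece I M (k + 1) = I • (N ⊓ adicPiece I M k) := by
  refine ⟨fun h k hk => ?_, fun h i hi => ?_⟩
  · rw [h (k + 1) (by omega), h k hk, ← Submodule.mul_smul, ← pow_succ',
      Nat.sub_add_comm hk]
  · induction i, hi using Nat.le_induction with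
    | base => simp
    | succ k hk ih =>
      rw [h k hk, ih, ← Submodule.mul_smul, ← pow_succ', Nat.sub_add_comm hk]

end ArtinRees

/-- The Artin–Rees number `ρ(N, M)` equals
`max { k : (N*/n N*)_k ≠ 0 }`, where `n` is the graded maximal ideal of `S = gr_m(R)`.
Degreewise, the lift to `m^k M` of the degree-`k` piece of `N*` is
`Nstar k = m^k M ∩ π^{-1}(m^{k+1}(M/N))` (where `π : M → M/N`), and the lift of the
degree-`k` piece of `n N*` is `Σ_{j=1}^{k} m^j · Nstar (k-j) + m^{k+1} M`; the condition
`(N*/n N*)_k ≠ 0` says that the former is not contained in the latter. -/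
theorem statement2 {R : Type*} [CommRing R] [IsNoetherianRing R] [IsLocalRing R]
    {M : Type*} [AddCommGroup M] [Module R M] [Module.Finite R M]
    (N : Submodule R M) :
    artinReesNumber (maximalIdeal R) N ⊤ =
      sSup {k : ℕ |
        ¬ (adicPiece (maximalIdeal R) M k ⊓
              Submodule.comap N.mkQ (adicPiece (maximalIdeal R) (M ⧸ N) (k + 1)) ≤
            (⨆ j ∈ Finset.Icc 1 k,
              maximalIdeal R ^ j •
                (adicPiece (maximalIdeal R) M (k - j) ⊓
                  Submodule.comap N.mkQ (adicPiece (maximalIdeal R) (M ⧸ N) (k - j + 1)))) ⊔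
            adicPiece (maximalIdeal R) M (k + 1))} := by
  set I := maximalIdeal R
  set B : Set ℕ := {k : ℕ | ¬ (adicPiece I M k ⊓
      Submodule.comap N.mkQ (adicPiece I (M ⧸ N) (k + 1)) ≤
        (⨆ j ∈ Finset.Icc 1 k, I ^ j • (adicPiece I M (k - j) ⊓
          Submodule.comap N.mkQ (adicPiece I (M ⧸ N) (k - j + 1)))) ⊔
            adicPiece I M (k + 1))}
  set A : Set ℕ := {r : ℕ | ∀ i : ℕ, r ≤ i →
    N ⊓ adicPiece I M i = I ^ (i - r) • (N ⊓ adicPiece I M r)}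
  change sInf A = sSup B
  have hne : A.Nonempty := by
    obtain ⟨r, hr⟩ := I.exists_pow_inf_eq_pow_smul N
    exact ⟨r, fun i hi => by rw [inf_comm, hr i hi, inf_comm]⟩
  have hbound : ∀ r ∈ A, r ∈ upperBounds B := by
    intro r hr k hk
    by_contra! hlt
    obtain ⟨l, rfl⟩ := Nat.exists_eq_add_of_le' (Nat.one_le_of_lt hlt)
    refine hk ((initial_succ_le_iff I N l).mpr ?_)
    rw [(forall_inf_pow_smul_eq_iff I N r).mp hr l (by omega)]
    exact le_sup_left
  have hbdd : BddAbove B := hne.elim fun r hr => ⟨r, hbound r hr⟩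
  refine le_antisymm (Nat.sInf_le ?_) (csSup_le' (hbound _ (Nat.sInf_mem hne)))
  obtain ⟨r, hr⟩ := hne
  have hstep := (forall_inf_pow_smul_eq_iff I N r).mp hr
  refine (forall_inf_pow_smul_eq_iff I N _).mpr fun k hk => ?_
  -- Descending induction, starting from any degree `r` beyond which `N` is already stable.
  induction hd : r - k generalizing k with
  | zero => exact hstep k (by omega)
  | succ d ih =>
    have hmul : I • (N ⊓ adicPiece I M k) ≤ N ⊓ adicPiece I M (k + 1) := by
      simpa [add_comm] using pow_smul_inf_adicPiece_le I N 1 k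
    refine le_antisymm ?_ hmul
    have hk_not : k + 1 ∉ B := fun hmem => by
      have := le_csSup hbdd hmem
      omega
    have hle := (initial_succ_le_iff I N k).mp (not_not.mp hk_not)
    calc N ⊓ adicPiece I M (k + 1)
        ≤ (I • (N ⊓ adicPiece I M k) ⊔ adicPiece I M (k + 1 + 1)) ⊓ N := le_inf hle inf_le_left
      _ = I • (N ⊓ adicPiece I M k) ⊔ N ⊓ adicPiece I M (k + 1 + 1) := by
          rw [sup_inf_assoc_of_le _ (hmul.trans inf_le_left), inf_comm N (adicPiece I M (k + 1 + 1))]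
      _ = I • (N ⊓ adicPiece I M k) ⊔ I • (N ⊓ adicPiece I M (k + 1)) := by
          rw [ih (k + 1) (by omega) (by omega)]
      _ ≤ I • (N ⊓ adicPiece I M k) :=
          sup_le le_rfl (Submodule.smul_mono le_rfl (inf_le_inf_left _
            (Submodule.smul_mono_left (Ideal.pow_le_pow_right k.le_succ))))
end

section
/- Let K be a field, T = K[x_1,…,x_n,y_1,…,y_m] the standard bigraded polynomial ring (each x_i of bidegree (1,0), each y_j of bidegree (0,1)), A = K[x_1,…,x_n], and W a finitely generated bigraded T-module. For each integer k let W_k = ⊕_j W_{jk}, a finitely generated graded A-module. Then reg_0(W_k), the maximal degree of an element in a minimal homogeneous generating set of W_k over A, is constant for all sufficiently large k. -/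
open MvPolynomial Submodule

namespace BigradedModule

/-- The bidegrees of the variables of `K[x_1,…,x_n,y_1,…,y_m]`. -/
abbrev bidegree (n m : ℕ) : Fin n ⊕ Fin m → ℕ × ℕ :=
  Sum.elim (fun _ => ((1 : ℕ), (0 : ℕ))) (fun _ => ((0 : ℕ), (1 : ℕ)))

lemma exists_inl_of_weight_fst_ne_zero {n m : ℕ} {a : Fin n ⊕ Fin m →₀ ℕ}
    (h : (Finsupp.weight (bidegree n m) a).1 ≠ 0) : ∃ i, a (Sum.inl i) ≠ 0 := by
  contrapose! h
  rw [Finsupp.weight_apply, Finsupp.sum_fintype _ _ (by simp)]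
  simp [Fintype.sum_sum_type, h, Prod.fst_sum]

lemma exists_inr_of_weight_snd_ne_zero {n m : ℕ} {a : Fin n ⊕ Fin m →₀ ℕ}
    (h : (Finsupp.weight (bidegree n m) a).2 ≠ 0) : ∃ l, a (Sum.inr l) ≠ 0 := by
  contrapose! h
  rw [Finsupp.weight_apply, Finsupp.sum_fintype _ _ (by simp)]
  simp [Fintype.sum_sum_type, h, Prod.snd_sum]

lemma exists_single_add {σ : Type*} {a : σ →₀ ℕ} {s : σ} (h : a s ≠ 0) :
    ∃ b, a = Finsupp.single s 1 + b :=
  ⟨a - Finsupp.single s 1, (add_tsub_cancel_of_le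
    (Finsupp.single_le_iff.2 (Nat.one_le_iff_ne_zero.2 h))).symm⟩

variable {K : Type*} [Field K] {n m : ℕ} {W : Type*} [AddCommGroup W]
  [Module (MvPolynomial (Fin n ⊕ Fin m) K) W]

lemma monomial_single_add_smul (s : Fin n ⊕ Fin m) (b : Fin n ⊕ Fin m →₀ ℕ) (h : W) :
    monomial (Finsupp.single s 1 + b) (1 : K) • h =
      (X s : MvPolynomial (Fin n ⊕ Fin m) K) • monomial b (1 : K) • h := by
  rw [smul_smul, X, monomial_mul, one_mul]

/-- A finitely generated bigraded module is generated in bounded bidegrees: each bigraded piece is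
spanned by the monomial multiples of homogeneous elements of bidegree at most a fixed `Q`. -/
lemma exists_le_span_monomial_smul [Module K W]
    [IsScalarTower K (MvPolynomial (Fin n ⊕ Fin m) K) W]
    [Module.Finite (MvPolynomial (Fin n ⊕ Fin m) K) W]
    (𝒲 : ℕ × ℕ → Submodule K W) [DirectSum.Decomposition 𝒲]
    (hmon : ∀ (a : Fin n ⊕ Fin m →₀ ℕ) (q : ℕ × ℕ) (w : W), w ∈ 𝒲 q →
      monomial a (1 : K) • w ∈ 𝒲 (Finsupp.weight (bidegree n m) a + q)) :
    ∃ Q : ℕ × ℕ, ∀ p, 𝒲 p ≤ span K {w | ∃ (a : Fin n ⊕ Fin m →₀ ℕ) (q : ℕ × ℕ) (h : W),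
      q ≤ Q ∧ h ∈ 𝒲 q ∧ Finsupp.weight (bidegree n m) a + q = p ∧
        monomial a (1 : K) • h = w} := by
  classical
  obtain ⟨G, hG⟩ := Module.Finite.fg_top (R := MvPolynomial (Fin n ⊕ Fin m) K) (M := W)
  set Q : ℕ × ℕ := (G.biUnion fun g => (DirectSum.decompose 𝒲 g).support).sup id
  refine ⟨Q, fun p => ?_⟩
  set S : Submodule K W := span K {w | ∃ (a : Fin n ⊕ Fin m →₀ ℕ) (q : ℕ × ℕ) (h : W),
      q ≤ Q ∧ h ∈ 𝒲 q ∧ monomial a (1 : K) • h = w}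
  have smul_mem (q : ℕ × ℕ) (hq : q ≤ Q) (h : W) (hh : h ∈ 𝒲 q)
      (f : MvPolynomial (Fin n ⊕ Fin m) K) : f • h ∈ S := by
    induction f using MvPolynomial.induction_on' with
    | monomial a c =>
      have : monomial a c = c • monomial a (1 : K) := by simp [smul_monomial]
      rw [this, smul_assoc]
      exact S.smul_mem c (subset_span ⟨a, q, h, hq, hh, rfl⟩)
    | add f g hf hg => rw [add_smul]; exact S.add_mem hf hg
  have mem_S (w : W) : ∀ f : MvPolynomial (Fin n ⊕ Fin m) K, f • w ∈ S := by
    have hw : w ∈ span (MvPolynomial (Fin n ⊕ Fin m) K) (G : Set W) := hG ▸ mem_top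
    induction hw using span_induction with
    | mem g hg =>
      intro f
      rw [← DirectSum.sum_support_decompose 𝒲 g, Finset.smul_sum]
      refine S.sum_mem fun q hq => smul_mem q ?_ _ (SetLike.coe_mem _) f
      exact Finset.le_sup (f := id) (Finset.mem_biUnion.2 ⟨g, hg, hq⟩)
    | zero => intro f; rw [smul_zero]; exact S.zero_mem
    | add u v _ _ hu hv => intro f; rw [smul_add]; exact S.add_mem (hu f) (hv f)
    | smul a u _ hu => intro f; rw [smul_smul]; exact hu _
  intro w hw
  have hwS : w ∈ S := by simpa using mem_S w 1
  rw [← DirectSum.decompose_of_mem_same 𝒲 hw]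
  clear hw
  induction hwS using span_induction with
  | mem w hw =>
    obtain ⟨a, q, h, hq, hh, rfl⟩ := hw
    by_cases hp : Finsupp.weight (bidegree n m) a + q = p
    · rw [DirectSum.decompose_of_mem_same 𝒲 (hp ▸ hmon a q h hh)]
      exact subset_span ⟨a, q, h, hq, hh, hp, rfl⟩
    · rw [DirectSum.decompose_of_mem_ne 𝒲 (hmon a q h hh) hp]
      exact zero_mem _
  | zero => simp
  | add u v _ _ hu hv => simpa using add_mem hu hv
  | smul c u _ hu =>
    rw [DirectSum.decompose_smul]
    exact Submodule.smul_mem _ c hu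

/-- A sequence of sets of natural numbers that is bounded and eventually decreasing is eventually
constant. -/
lemma exists_eventually_eq_of_subset {S : ℕ → Set ℕ} {D E : ℕ} (hD : ∀ k, ∀ j ∈ S k, j ≤ D)
    (hE : ∀ k, E ≤ k → S (k + 1) ⊆ S k) : ∃ r, ∀ k, r ≤ k → S k = S r := by
  have hfin (k : ℕ) : (S k).Finite := (Set.finite_Iic D).subset fun j hj => hD k j hj
  have hanti {k l : ℕ} (hk : E ≤ k) (hkl : k ≤ l) : S l ⊆ S k := by
    induction l, hkl using Nat.le_induction with
    | base => exact subset_rfl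
    | succ l hl ih => exact (hE l (hk.trans hl)).trans ih
  obtain ⟨r, hr, hmin⟩ := (measure fun k => (S k).ncard).wf.has_min (Set.Ici E) ⟨E, Set.self_mem_Ici⟩
  refine ⟨r, fun k hk => Set.eq_of_subset_of_ncard_le (hanti hr hk) ?_ (hfin r)⟩
  exact not_lt.1 (hmin k (le_trans hr hk))

end BigradedModule

/-- Let `K` be a field, `T = K[x_1,…,x_n,y_1,…,y_m]` the standard bigraded
polynomial ring (each `x_i` of bidegree `(1,0)`, each `y_j` of bidegree `(0,1)`),
`A = K[x_1,…,x_n]`, and `W` a finitely generated bigraded `T`-module, with bigrading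
`𝒲 : ℕ × ℕ → Submodule K W` compatible with the bigrading of `T`.  For each `k` let
`W_k = ⊕_j W_{(j,k)}`, a finitely generated graded `A`-module (`A` acts through the
`x`-variables).  Then `reg_0(W_k)`, the largest `j` such that `(W_k / A_+ W_k)_j ≠ 0`
(the maximal degree of a minimal homogeneous generator of `W_k`, where
`A_+ W_k = Σ_i x_i W_k`), is constant for all sufficiently large `k`. -/
theorem statement6 (K : Type*) [Field K] (n m : ℕ)
    (W : Type*) [AddCommGroup W]
    [Module (MvPolynomial (Fin n ⊕ Fin m) K) W] [Module K W]
    [IsScalarTower K (MvPolynomial (Fin n ⊕ Fin m) K) W]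
    [SMulCommClass (MvPolynomial (Fin n ⊕ Fin m) K) K W]
    [Module.Finite (MvPolynomial (Fin n ⊕ Fin m) K) W]
    (𝒲 : ℕ × ℕ → Submodule K W) [DirectSum.Decomposition 𝒲]
    (hcompat : ∀ (p : ℕ × ℕ) (a : MvPolynomial (Fin n ⊕ Fin m) K),
      a ∈ weightedHomogeneousSubmodule K (Sum.elim (fun _ => ((1 : ℕ), (0 : ℕ)))
          (fun _ => ((0 : ℕ), (1 : ℕ)))) p →
      ∀ (q : ℕ × ℕ) (w : W), w ∈ 𝒲 q → a • w ∈ 𝒲 (p + q)) :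
    ∃ r c : ℕ, ∀ k : ℕ, r ≤ k →
      sSup {j : ℕ | ¬ (𝒲 (j, k) ≤
        ⨆ i : Fin n,
          Submodule.map
            (DistribMulAction.toLinearMap K W
              (MvPolynomial.X (Sum.inl i) : MvPolynomial (Fin n ⊕ Fin m) K))
            (⨆ j' : ℕ, 𝒲 (j', k)))} = c := by
  have hmon (a : Fin n ⊕ Fin m →₀ ℕ) (q : ℕ × ℕ) (w : W) (hw : w ∈ 𝒲 q) :
      monomial a (1 : K) • w ∈ 𝒲 (Finsupp.weight (BigradedModule.bidegree n m) a + q) :=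
    hcompat _ _ (isWeightedHomogeneous_monomial _ _ _ rfl) q w hw
  obtain ⟨Q, hQ⟩ := BigradedModule.exists_le_span_monomial_smul 𝒲 hmon
  set M : ℕ → Submodule K W := fun k => ⨆ i : Fin n,
    Submodule.map (DistribSMul.toLinearMap K W
      (MvPolynomial.X (Sum.inl i) : MvPolynomial (Fin n ⊕ Fin m) K)) (⨆ j' : ℕ, 𝒲 (j', k))
  have smul_mem_M (k : ℕ) (i : Fin n) {j : ℕ} {w : W} (hw : w ∈ 𝒲 (j, k)) :
      (X (Sum.inl i) : MvPolynomial (Fin n ⊕ Fin m) K) • w ∈ M k :=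
    mem_iSup_of_mem i (Submodule.mem_map_of_mem
      (f := DistribSMul.toLinearMap K W
        (MvPolynomial.X (Sum.inl i) : MvPolynomial (Fin n ⊕ Fin m) K))
      (mem_iSup_of_mem (p := fun j' => 𝒲 (j', k)) j hw))
  have smul_M (k : ℕ) (l : Fin m) : M k ≤ (M (k + 1)).comap (DistribSMul.toLinearMap K W
      (X (Sum.inr l) : MvPolynomial (Fin n ⊕ Fin m) K)) := by
    refine iSup_le fun i => Submodule.map_le_iff_le_comap.2 (iSup_le fun j w hw => ?_)
    have hy : (X (Sum.inr l) : MvPolynomial (Fin n ⊕ Fin m) K) • w ∈ 𝒲 (j, k + 1) := by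
      have := hcompat _ _ (isWeightedHomogeneous_X K _ (Sum.inr l)) _ w hw
      simpa [add_comm] using this
    have := smul_mem_M (k + 1) i hy
    rw [smul_comm] at this
    exact this
  have hD (k j : ℕ) (hj : ¬ 𝒲 (j, k) ≤ M k) : j ≤ Q.1 := by
    by_contra! hlt
    refine hj ((hQ (j, k)).trans (span_le.2 ?_))
    rintro _ ⟨a, q, h, hq, hh, hp, rfl⟩
    have h1 := congrArg Prod.fst hp
    have hq1 := hq.1
    simp only [Prod.fst_add] at h1
    obtain ⟨i, hi⟩ := BigradedModule.exists_inl_of_weight_fst_ne_zero (a := a) (by omega)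
    obtain ⟨b, rfl⟩ := BigradedModule.exists_single_add hi
    rw [SetLike.mem_coe, BigradedModule.monomial_single_add_smul]
    refine smul_mem_M k i (j := j - 1) ?_
    rw [map_add, Finsupp.weight_single, add_assoc] at hp
    have hb : Finsupp.weight (BigradedModule.bidegree n m) b + q = (j - 1, k) := by
      simp only [Prod.ext_iff, Prod.fst_add, Prod.snd_add, Prod.smul_fst, Prod.smul_snd,
        BigradedModule.bidegree, Sum.elim_inl, smul_eq_mul] at hp ⊢
      omega
    exact hb ▸ hmon b q h hh
  have hE (k : ℕ) (hk : Q.2 ≤ k) (j : ℕ) (hj : 𝒲 (j, k) ≤ M k) : 𝒲 (j, k + 1) ≤ M (k + 1) := by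
    refine (hQ (j, k + 1)).trans (span_le.2 ?_)
    rintro _ ⟨a, q, h, hq, hh, hp, rfl⟩
    have h2 := congrArg Prod.snd hp
    have hq2 := hq.2
    simp only [Prod.snd_add] at h2
    obtain ⟨l, hl⟩ := BigradedModule.exists_inr_of_weight_snd_ne_zero (a := a) (by omega)
    obtain ⟨b, rfl⟩ := BigradedModule.exists_single_add hl
    rw [SetLike.mem_coe, BigradedModule.monomial_single_add_smul]
    refine smul_M k l (hj ?_)
    rw [map_add, Finsupp.weight_single, add_assoc] at hp
    have hb : Finsupp.weight (BigradedModule.bidegree n m) b + q = (j, k) := by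
      simp only [Prod.ext_iff, Prod.fst_add, Prod.snd_add, Prod.smul_fst, Prod.smul_snd,
        BigradedModule.bidegree, Sum.elim_inr, smul_eq_mul] at hp ⊢
      omega
    exact hb ▸ hmon b q h hh
  obtain ⟨r, hr⟩ := BigradedModule.exists_eventually_eq_of_subset
    (S := fun k => {j | ¬ 𝒲 (j, k) ≤ M k}) hD fun k hk j hj hjk => hj (hE k hk j hjk)
  exact ⟨r, _, fun k hk => congrArg sSup (hr k hk)⟩
end

section
/- Let (R,m) be a regular local ring or the polynomial ring over a field K, and I ⊆ m an ideal (graded if R is the polynomial ring). Then there exists an integer s' such that for all s ≥ s', all i ≥ 1 and all j ≥ 0, one has I^j ∗ H_i(R/I^s) = H_i(R/I^{s+j}), i.e. the map I^j ⊗ H_i(R/I^s) → H_i(R/I^{s+j}) induced by the multiplication map a ⊗ [u + I^s K_i(R)] ↦ [a·u + I^{s+j} K_i(R)] on Koszul homology is surjective. -/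
open Submodule IsLocalRing

/-- The Koszul differential on the exterior algebra `Λ = ⋀ S^n` associated with a sequence
`y_1, …, y_n ∈ S`: contraction (interior product) with the linear functional sending the
`i`-th basis vector to `y_i`.  The Koszul complex `K(y; S)` of the sequence `y` is `Λ`
with this differential, `K_i = ⋀^i S^n` being its `i`-th homogeneous component. -/
noncomputable def koszulDiff (S : Type*) [CommRing S] {n : ℕ} (y : Fin n → S) :
    ExteriorAlgebra S (Fin n → S) →ₗ[S] ExteriorAlgebra S (Fin n → S) :=
  CliffordAlgebra.contractLeft (∑ i, y i • (LinearMap.proj i : (Fin n → S) →ₗ[S] S))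

theorem span_range_eq_of_isUnit {R : Type*} [CommRing R] {n : ℕ} (x : Fin (n + 1) → R)
    (c : Fin (n + 1) → R) (i : Fin (n + 1)) (hc : IsUnit (c i)) :
    Ideal.span (Set.range x) ≤
      Ideal.span {∑ j, c j * x j} ⊔ Ideal.span (Set.range fun j ↦ x (i.succAbove j)) := by
  have h1 : ∀ j, x (i.succAbove j) ∈ Ideal.span {∑ j, c j * x j} ⊔
      Ideal.span (Set.range fun j ↦ x (i.succAbove j)) := fun j ↦
    Ideal.mem_sup_right (Ideal.subset_span ⟨j, rfl⟩)
  rw [Ideal.span_le]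
  rintro _ ⟨j, rfl⟩
  rcases Fin.eq_self_or_eq_succAbove i j with rfl | ⟨k, rfl⟩
  · refine (Ideal.unit_mul_mem_iff_mem _ hc).1 ?_
    have h2 : c j * x j = (∑ k, c k * x k) - ∑ k, c (j.succAbove k) * x (j.succAbove k) := by
      rw [Fin.sum_univ_succAbove _ j]; ring
    rw [h2]
    exact sub_mem (Ideal.mem_sup_left (Ideal.mem_span_singleton_self _))
      (sum_mem fun k _ ↦ Ideal.mul_mem_left _ _ (h1 k))
  · exact h1 k

theorem exists_mem_maximalIdeal_notMem_sq_notMem_minimalPrimes {R : Type*} [CommRing R]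
    [IsNoetherianRing R] [IsLocalRing R] (h : 0 < ringKrullDim R) :
    ∃ y ∈ maximalIdeal R, y ∉ maximalIdeal R ^ 2 ∧ ∀ p ∈ minimalPrimes R, y ∉ p := by
  have hmin : maximalIdeal R ∉ minimalPrimes R := by
    intro hm
    rw [← Ideal.height_eq_zero_iff] at hm
    rw [← IsLocalRing.maximalIdeal_height_eq_ringKrullDim, hm] at h
    exact lt_irrefl _ h
  by_contra! hcon
  have hfin := minimalPrimes.finite_of_isNoetherianRing R
  have hsub : (maximalIdeal R : Set R) ⊆
      ⋃ p ∈ (↑(insert (maximalIdeal R ^ 2) hfin.toFinset) : Set (Ideal R)),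
        ((id p : Ideal R) : Set R) := by
    intro y hy
    simp only [Set.mem_iUnion]
    by_cases h2 : y ∈ maximalIdeal R ^ 2
    · exact ⟨_, by simp, h2⟩
    · obtain ⟨p, hp, hyp⟩ := hcon y hy h2
      exact ⟨p, by simp [hp], hyp⟩
  obtain ⟨p, hp, hle⟩ := (Ideal.subset_union_prime (maximalIdeal R ^ 2) (maximalIdeal R ^ 2) (by
    intro p hp hne _
    have hp' : p ∈ minimalPrimes R := by simpa [hne] using hp
    exact hp'.1.1)).1 hsub
  rw [Finset.mem_insert, Set.Finite.mem_toFinset] at hp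
  rcases hp with rfl | hp
  · apply hmin
    have : maximalIdeal R = ⊥ := Submodule.eq_bot_of_le_smul_of_le_jacobson_bot (maximalIdeal R) _
      (IsNoetherian.noetherian _) (by simpa [sq] using hle) (maximalIdeal_le_jacobson _)
    exact ⟨⟨inferInstance, bot_le⟩, fun q _ _ ↦ this ▸ bot_le⟩
  · have h3 : maximalIdeal R = p :=
      le_antisymm hle (IsLocalRing.le_maximalIdeal hp.1.1.ne_top)
    exact hmin (h3 ▸ hp)

theorem isLocalRing_quotient {R : Type*} [CommRing R] [IsLocalRing R] {J : Ideal R}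
    (hJ : J ≤ maximalIdeal R) : IsLocalRing (R ⧸ J) := by
  have : Nontrivial (R ⧸ J) := Ideal.Quotient.nontrivial_iff.mpr
    (ne_top_of_le_ne_top (Ideal.IsPrime.ne_top inferInstance) hJ)
  exact IsLocalRing.of_surjective' (Ideal.Quotient.mk J) Ideal.Quotient.mk_surjective

theorem maximalIdeal_quotient {R : Type*} [CommRing R] [IsLocalRing R] {J : Ideal R}
    [IsLocalRing (R ⧸ J)] {ι : Type*} (x : ι → R)
    (hx : maximalIdeal R = J ⊔ Ideal.span (Set.range x)) :
    Ideal.span (Set.range fun j ↦ Ideal.Quotient.mk J (x j)) = maximalIdeal (R ⧸ J) := by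
  rw [← map_maximalIdeal_of_surjective (Ideal.Quotient.mk J) Ideal.Quotient.mk_surjective, hx,
    Ideal.map_sup, Ideal.map_quotient_self, bot_sup_eq, Ideal.map_span, ← Set.range_comp]
  rfl

theorem le_ringKrullDim_quotient_span {R : Type*} [CommRing R] [IsNoetherianRing R]
    [IsLocalRing R] (s : Finset R) (hs : (s : Set R) ⊆ maximalIdeal R) {m : ℕ}
    (h : ((m + s.card : ℕ) : WithBot ℕ∞) ≤ ringKrullDim R) :
    m ≤ ringKrullDim (R ⧸ Ideal.span (s : Set R)) := by
  have h2 := h.trans (ringKrullDim_le_ringKrullDim_quotient_add_card s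
    (hs.trans (by rw [← Ideal.jacobson_bot]; exact maximalIdeal_le_jacobson _)))
  push_cast at h2
  exact (ENat.WithBot.add_le_add_natCast_right_iff).1 h2

theorem isDomain_of_span_range_eq_maximalIdeal {R : Type*} [CommRing R] [IsNoetherianRing R]
    [IsLocalRing R] {n : ℕ} (x : Fin n → R) (hx : Ideal.span (Set.range x) = maximalIdeal R)
    (hn : n ≤ ringKrullDim R) : IsDomain R := by
  induction n generalizing R with
  | zero =>
    have : maximalIdeal R = ⊥ := by rw [← hx]; simp
    exact ((IsLocalRing.isField_iff_maximalIdeal_eq).2 this).isDomain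
  | succ n ih =>
    obtain ⟨y, hy, hy2, hyp⟩ := exists_mem_maximalIdeal_notMem_sq_notMem_minimalPrimes
      (R := R) (lt_of_lt_of_le (by exact_mod_cast Nat.succ_pos n) hn)
    obtain ⟨c, rfl⟩ := Ideal.mem_span_range_iff_exists_fun.1 (hx ▸ hy)
    have hxm : ∀ j, x j ∈ maximalIdeal R := fun j ↦ hx ▸ Ideal.subset_span ⟨j, rfl⟩
    obtain ⟨i, hi⟩ : ∃ i, IsUnit (c i) := by
      by_contra! hcon
      refine hy2 (sum_mem fun j _ ↦ ?_)
      rw [sq]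
      exact Ideal.mul_mem_mul ((mem_maximalIdeal _).2 (hcon j)) (hxm j)
    set y := ∑ j, c j * x j with hydef
    have hm : maximalIdeal R = Ideal.span {y} ⊔
        Ideal.span (Set.range fun j ↦ x (i.succAbove j)) := by
      apply le_antisymm
      · exact hx ▸ span_range_eq_of_isUnit x c i hi
      · rw [sup_le_iff, Ideal.span_le, Ideal.span_le]
        constructor
        · simpa using hy
        · rintro _ ⟨j, rfl⟩
          exact hxm _
    have hJ : Ideal.span {y} ≤ maximalIdeal R := hm ▸ le_sup_left
    have := isLocalRing_quotient hJ
    have hdim : (n : WithBot ℕ∞) ≤ ringKrullDim (R ⧸ Ideal.span {y}) := by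
      have := le_ringKrullDim_quotient_span (R := R) (m := n) {y}
        (by simpa using hy) (by simpa using hn)
      rwa [Finset.coe_singleton] at this
    have hdom := ih _ (maximalIdeal_quotient _ hm) hdim
    have hprime : (Ideal.span {y}).IsPrime := (Ideal.Quotient.isDomain_iff_prime _).1 hdom
    obtain ⟨p, hp, hpy⟩ := Ideal.exists_minimalPrimes_le (I := ⊥) (J := Ideal.span {y}) bot_le
    have hyp' := hyp p hp
    have hpp : p.IsPrime := hp.1.1
    have hbot : p = ⊥ := by
      refine Submodule.eq_bot_of_le_smul_of_le_jacobson_bot (maximalIdeal R) _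
        (IsNoetherian.noetherian _) (fun z hz ↦ ?_) (maximalIdeal_le_jacobson _)
      obtain ⟨a, rfl⟩ := Ideal.mem_span_singleton'.1 (hpy hz)
      rw [mul_comm]
      exact Ideal.mul_mem_mul hy ((hpp.mem_or_mem hz).resolve_right hyp')
    subst hbot
    exact IsDomain.of_bot_isPrime R

theorem isPrime_span_image_lt {R : Type*} [CommRing R] [IsNoetherianRing R]
    [IsLocalRing R] {n : ℕ} (x : Fin n → R) (hx : Ideal.span (Set.range x) = maximalIdeal R)
    (hn : n ≤ ringKrullDim R) {k : ℕ} (hk : k ≤ n) :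
    (Ideal.span (x '' {j | j.val < k})).IsPrime := by
  classical
  have hxm : ∀ j, x j ∈ maximalIdeal R := fun j ↦ hx ▸ Ideal.subset_span ⟨j, rfl⟩
  let s : Finset R := (Finset.univ.filter fun j : Fin n ↦ j.val < k).image x
  have hs : (s : Set R) = x '' {j | j.val < k} := by simp [s]
  have hcard : s.card ≤ k := by
    refine Finset.card_image_le.trans ?_
    rw [Fin.card_filter_val_lt]
    exact min_le_right _ _
  have hsm : (s : Set R) ⊆ maximalIdeal R := by
    rw [hs]
    rintro _ ⟨j, -, rfl⟩
    exact hxm j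
  have hJ : Ideal.span (s : Set R) ≤ maximalIdeal R := Ideal.span_le.2 hsm
  rw [← hs, ← Ideal.Quotient.isDomain_iff_prime]
  have := isLocalRing_quotient hJ
  have hm : maximalIdeal R = Ideal.span (s : Set R) ⊔
      Ideal.span (Set.range fun j : Fin (n - k) ↦ x ⟨k + j, by omega⟩) := by
    apply le_antisymm
    · rw [← hx, Ideal.span_le]
      rintro _ ⟨j, rfl⟩
      by_cases hj : j.val < k
      · exact Ideal.mem_sup_left (Ideal.subset_span (hs ▸ ⟨j, hj, rfl⟩))
      · refine Ideal.mem_sup_right (Ideal.subset_span ⟨⟨j - k, by omega⟩, ?_⟩)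
        exact congrArg x (Fin.ext (by simp; omega))
    · refine sup_le hJ (Ideal.span_le.2 ?_)
      rintro _ ⟨j, rfl⟩
      exact hxm _
  refine isDomain_of_span_range_eq_maximalIdeal _ (maximalIdeal_quotient _ hm)
    (le_ringKrullDim_quotient_span s hsm (le_trans ?_ hn))
  exact_mod_cast (by omega : n - k + s.card ≤ n)

theorem card_le_of_minimal_generators {R : Type*} [CommRing R] [IsNoetherianRing R]
    [IsLocalRing R] {n d : ℕ} (x : Fin n → R) (hx : Ideal.span (Set.range x) = maximalIdeal R)
    (hxmin : ∀ i, x i ∉ Ideal.span (x '' {j | j ≠ i}))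
    (y : Fin d → R) (hy : Ideal.span (Set.range y) = maximalIdeal R) : n ≤ d := by
  by_contra! hlt
  have hxm : ∀ j, x j ∈ maximalIdeal R := fun j ↦ hx ▸ Ideal.subset_span ⟨j, rfl⟩
  have hym : ∀ j, y j ∈ maximalIdeal R := fun j ↦ hy ▸ Ideal.subset_span ⟨j, rfl⟩
  choose A hA using fun i ↦ Ideal.mem_span_range_iff_exists_fun.1 (hy ▸ hxm i)
  let M : Matrix (Fin d) (Fin n) (ResidueField R) := fun j i ↦ residue R (A i j)
  have hker : LinearMap.ker M.mulVecLin ≠ ⊥ := LinearMap.ker_ne_bot_of_finrank_lt (by simpa)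
  obtain ⟨v, hv, hv0⟩ := Submodule.exists_mem_ne_zero_of_ne_bot hker
  choose c hc using fun i ↦ residue_surjective (v i)
  obtain ⟨i, hi⟩ := Function.ne_iff.1 hv0
  have hci : IsUnit (c i) := by
    rw [← residue_ne_zero_iff_isUnit, hc]
    exact hi
  have hsq : ∑ i, c i * x i ∈ maximalIdeal R • maximalIdeal R := by
    have h1 : ∑ i, c i * x i = ∑ j, (∑ i, c i * A i j) * y j := by
      simp_rw [← hA, Finset.mul_sum, Finset.sum_mul]
      rw [Finset.sum_comm]
      simp only [mul_assoc]
    rw [h1]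
    refine sum_mem fun j _ ↦ Ideal.mul_mem_mul ?_ (hym j)
    rw [← residue_eq_zero_iff, map_sum]
    have h2 : M.mulVec v j = 0 := congrFun (LinearMap.mem_ker.1 hv) j
    rw [← h2]
    exact Finset.sum_congr rfl fun i _ ↦ by rw [map_mul, hc, mul_comm]
  obtain ⟨n, rfl⟩ : ∃ m, n = m + 1 := ⟨n - 1, by omega⟩
  have hle : maximalIdeal R ≤ Ideal.span (Set.range fun j ↦ x (i.succAbove j)) := by
    refine Submodule.le_of_le_smul_of_le_jacobson_bot (IsNoetherian.noetherian _)
      (maximalIdeal_le_jacobson _) ?_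
    calc maximalIdeal R = Ideal.span (Set.range x) := hx.symm
      _ ≤ _ := span_range_eq_of_isUnit x c i hci
      _ ≤ _ := sup_le (le_sup_of_le_right ?_) le_sup_left
    rw [Ideal.span_le]
    simpa using hsq
  refine hxmin i (Ideal.span_mono ?_ (hle (hxm i)))
  rintro _ ⟨j, rfl⟩
  exact ⟨_, Fin.succAbove_ne i j, rfl⟩

section Koszul

variable {R : Type*} [CommRing R] {n : ℕ}

/-- The exterior monomials in the basis vectors `e_0, …, e_{k-1}` span this submodule. -/
noncomputable def exteriorInitial (R : Type*) [CommRing R] (n : ℕ) :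
    ℕ → Submodule R (ExteriorAlgebra R (Fin n → R))
  | 0 => LinearMap.range (Algebra.linearMap R _)
  | k + 1 => exteriorInitial R n k ⊔
      if h : k < n then
        (exteriorInitial R n k).map
          (LinearMap.mulLeft R (ExteriorAlgebra.ι R (Pi.single ⟨k, h⟩ (1 : R))))
      else ⊥

theorem mem_exteriorInitial_succ (k : Fin n) (w : ExteriorAlgebra R (Fin n → R)) :
    w ∈ exteriorInitial R n (k + 1) ↔ ∃ a ∈ exteriorInitial R n k, ∃ b ∈ exteriorInitial R n k,
      a + ExteriorAlgebra.ι R (Pi.single k (1 : R)) * b = w := by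
  rw [exteriorInitial, dif_pos k.2, Submodule.mem_sup]
  simp

theorem algebraMap_mem_exteriorInitial (r : R) (k : ℕ) :
    algebraMap R _ r ∈ exteriorInitial R n k := by
  induction k with
  | zero => exact ⟨r, rfl⟩
  | succ k ih => exact Submodule.mem_sup_left ih

theorem exteriorInitial_fg (k : ℕ) : (exteriorInitial R n k).FG := by
  induction k with
  | zero => rw [exteriorInitial, LinearMap.range_eq_map]; exact Module.Finite.fg_top.map _
  | succ k ih =>
    rw [exteriorInitial]
    split_ifs with h
    · exact ih.sup (ih.map _)
    · exact ih.sup Submodule.fg_bot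

theorem ι_single_mul_mem_exteriorInitial (k : ℕ) (j : Fin n) (hj : j < k)
    (w : ExteriorAlgebra R (Fin n → R)) (hw : w ∈ exteriorInitial R n k) :
    ExteriorAlgebra.ι R (Pi.single j (1 : R)) * w ∈ exteriorInitial R n k := by
  induction k generalizing w with
  | zero => omega
  | succ k ih =>
    by_cases hk : k < n
    · lift k to Fin n using hk
      obtain ⟨a, ha, b, hb, rfl⟩ := (mem_exteriorInitial_succ k w).1 hw
      rw [mem_exteriorInitial_succ]
      rcases (Nat.lt_succ_iff_lt_or_eq.1 hj) with h | h
      · refine ⟨_, ih h a ha, _, neg_mem (ih h b hb), ?_⟩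
        have h1 := ExteriorAlgebra.ι_add_mul_swap (R := R)
          (Pi.single j (1 : R) : Fin n → R) (Pi.single k (1 : R))
        rw [mul_add, ← mul_assoc, eq_neg_of_add_eq_zero_left h1]
        simp [mul_assoc]
      · obtain rfl : j = k := Fin.ext h
        refine ⟨0, zero_mem _, a, ha, ?_⟩
        rw [mul_add, ← mul_assoc, ExteriorAlgebra.ι_sq_zero]
        simp
    · rw [exteriorInitial, dif_neg hk, sup_bot_eq] at hw ⊢
      exact ih (by omega) w hw

theorem exteriorInitial_eq_top : exteriorInitial R n n = ⊤ := by
  rw [eq_top_iff]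
  rintro w -
  induction w using CliffordAlgebra.left_induction with
  | algebraMap r => exact algebraMap_mem_exteriorInitial r n
  | add a b ha hb => exact add_mem ha hb
  | ι_mul a v ha =>
    have hv : v = ∑ j, v j • (Pi.single j (1 : R) : Fin n → R) := by
      ext l
      simp [Pi.single_apply]
    rw [hv, map_sum, Finset.sum_mul]
    refine sum_mem fun j _ ↦ ?_
    have h2 := Submodule.smul_mem _ (v j) (ι_single_mul_mem_exteriorInitial n j j.2 a ha)
    rw [map_smul, smul_mul_assoc]
    exact h2

instance exteriorAlgebra_pi_finite : Module.Finite R (ExteriorAlgebra R (Fin n → R)) :=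
  ⟨exteriorInitial_eq_top (R := R) (n := n) ▸ exteriorInitial_fg n⟩

theorem koszulDiff_ι_single_mul (x : Fin n → R) (k : Fin n)
    (w : ExteriorAlgebra R (Fin n → R)) :
    koszulDiff R x (ExteriorAlgebra.ι R (Pi.single k (1 : R)) * w) =
      x k • w - ExteriorAlgebra.ι R (Pi.single k (1 : R)) * koszulDiff R x w := by
  have h := CliffordAlgebra.contractLeft_ι_mul (Q := (0 : QuadraticForm R (Fin n → R)))
    (d := ∑ i, x i • (LinearMap.proj i : (Fin n → R) →ₗ[R] R)) (Pi.single k (1 : R)) w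
  have h2 : (∑ i, x i • (LinearMap.proj i : (Fin n → R) →ₗ[R] R)) (Pi.single k (1 : R)) = x k := by
    simp [LinearMap.sum_apply, Pi.single_apply]
  rw [h2] at h
  exact h

theorem koszulDiff_algebraMap (x : Fin n → R) (r : R) :
    koszulDiff R x (algebraMap R _ r) = 0 :=
  CliffordAlgebra.contractLeft_algebraMap _ _ r

theorem koszulDiff_koszulDiff (x : Fin n → R) (w : ExteriorAlgebra R (Fin n → R)) :
    koszulDiff R x (koszulDiff R x w) = 0 :=
  CliffordAlgebra.contractLeft_contractLeft _ w

theorem koszulDiff_mem_exteriorInitial (x : Fin n → R) (k : ℕ) (hk : k ≤ n)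
    (w : ExteriorAlgebra R (Fin n → R)) (hw : w ∈ exteriorInitial R n k) :
    koszulDiff R x w ∈ exteriorInitial R n k ∧
      ExteriorAlgebra.algebraMapInv (koszulDiff R x w) ∈ Ideal.span (x '' {j | j.val < k}) := by
  induction k generalizing w with
  | zero =>
    obtain ⟨r, rfl⟩ := hw
    rw [Algebra.linearMap_apply, koszulDiff_algebraMap]
    simp
  | succ k ih =>
    lift k to Fin n using hk
    obtain ⟨a, ha, b, hb, rfl⟩ := (mem_exteriorInitial_succ k w).1 hw
    have iha := ih k.2.le a ha
    have ihb := ih k.2.le b hb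
    rw [map_add, koszulDiff_ι_single_mul]
    constructor
    · rw [mem_exteriorInitial_succ]
      refine ⟨koszulDiff R x a + x k • b, add_mem iha.1 (Submodule.smul_mem _ _ hb), _,
        neg_mem ihb.1, ?_⟩
      rw [mul_neg]
      abel
    · have h1 : ExteriorAlgebra.algebraMapInv
        (ExteriorAlgebra.ι R (Pi.single k (1 : R) : Fin n → R)) =
          (0 : R) := by
        simp [ExteriorAlgebra.algebraMapInv]
      rw [map_add, map_sub, map_mul, h1, zero_mul, sub_zero, map_smul, smul_eq_mul]
      refine add_mem (Ideal.span_mono (Set.image_mono fun j hj ↦ ?_) iha.2)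
        (Ideal.mul_mem_right _ _ (Ideal.subset_span ⟨k, by simp, rfl⟩))
      exact Nat.lt_succ_of_lt hj

theorem contractLeft_proj_exteriorInitial (k : ℕ) (j : Fin n) (hj : k ≤ j)
    (w : ExteriorAlgebra R (Fin n → R)) (hw : w ∈ exteriorInitial R n k) :
    CliffordAlgebra.contractLeft (Q := (0 : QuadraticForm R (Fin n → R)))
      (LinearMap.proj j : (Fin n → R) →ₗ[R] R) w = 0 := by
  induction k generalizing w with
  | zero =>
    obtain ⟨r, rfl⟩ := hw
    exact CliffordAlgebra.contractLeft_algebraMap _ _ r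
  | succ k ih =>
    lift k to Fin n using by omega
    obtain ⟨a, ha, b, hb, rfl⟩ := (mem_exteriorInitial_succ k w).1 hw
    have h := CliffordAlgebra.contractLeft_ι_mul (Q := (0 : QuadraticForm R (Fin n → R)))
      (d := (LinearMap.proj j : (Fin n → R) →ₗ[R] R)) (Pi.single k (1 : R)) b
    have hjk : j ≠ k := by rintro rfl; omega
    rw [ih (by omega) b hb, mul_zero, sub_zero, LinearMap.proj_apply, Pi.single_eq_of_ne hjk,
      zero_smul] at h
    rw [map_add, ih (by omega) a ha, zero_add]
    exact h

theorem eq_zero_of_add_ι_single_mul_eq_zero (k : Fin n) {a b : ExteriorAlgebra R (Fin n → R)}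
    (ha : a ∈ exteriorInitial R n k) (hb : b ∈ exteriorInitial R n k)
    (h : a + ExteriorAlgebra.ι R (Pi.single k (1 : R)) * b = 0) : a = 0 ∧ b = 0 := by
  have h1 := CliffordAlgebra.contractLeft_ι_mul (Q := (0 : QuadraticForm R (Fin n → R)))
    (d := (LinearMap.proj k : (Fin n → R) →ₗ[R] R)) (Pi.single k (1 : R)) b
  rw [contractLeft_proj_exteriorInitial k k le_rfl b hb, mul_zero, sub_zero,
    LinearMap.proj_apply, Pi.single_eq_same, one_smul] at h1
  have h2 := congrArg (CliffordAlgebra.contractLeft (Q := (0 : QuadraticForm R (Fin n → R)))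
    (LinearMap.proj k : (Fin n → R) →ₗ[R] R)) h
  rw [map_add, contractLeft_proj_exteriorInitial k k le_rfl a ha, zero_add, map_zero] at h2
  have hb0 : b = 0 := h1.symm.trans h2
  subst hb0
  simpa using h

theorem exists_koszulDiff_eq (x : Fin n → R)
    (hreg : ∀ (k : Fin n) (r : R), x k * r ∈ Ideal.span (x '' {j | j.val < k.val}) →
      r ∈ Ideal.span (x '' {j | j.val < k.val}))
    (k : ℕ) (hk : k ≤ n) (w : ExteriorAlgebra R (Fin n → R)) (hw : w ∈ exteriorInitial R n k)
    (hdw : koszulDiff R x w = 0)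
    (hw0 : ExteriorAlgebra.algebraMapInv w ∈ Ideal.span (x '' {j | j.val < k})) :
    ∃ v ∈ exteriorInitial R n k, koszulDiff R x v = w := by
  induction k generalizing w with
  | zero =>
    obtain ⟨r, rfl⟩ := hw
    have hr : r = 0 := by
      simpa [ExteriorAlgebra.algebraMapInv] using hw0
    exact ⟨0, zero_mem _, by simp [hr]⟩
  | succ k ih =>
    lift k to Fin n using hk
    obtain ⟨a, ha, b, hb, rfl⟩ := (mem_exteriorInitial_succ k w).1 hw
    have hda := koszulDiff_mem_exteriorInitial x k k.2.le a ha
    have hdb := koszulDiff_mem_exteriorInitial x k k.2.le b hb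
    have hι : ExteriorAlgebra.algebraMapInv
        (ExteriorAlgebra.ι R (Pi.single k (1 : R) : Fin n → R)) =
        (0 : R) := by
      simp [ExteriorAlgebra.algebraMapInv]
    rw [map_add, koszulDiff_ι_single_mul] at hdw
    obtain ⟨h1, h2⟩ := eq_zero_of_add_ι_single_mul_eq_zero k
      (add_mem hda.1 (Submodule.smul_mem _ (x k) hb)) (neg_mem hdb.1) (by
        rw [← hdw, mul_neg]; abel)
    rw [neg_eq_zero] at h2
    have hb0 : ExteriorAlgebra.algebraMapInv b ∈ Ideal.span (x '' {j | j.val < k.val}) := by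
      apply hreg
      have h3 := congrArg ExteriorAlgebra.algebraMapInv h1
      rw [map_add, map_smul, map_zero, smul_eq_mul] at h3
      rw [eq_neg_of_add_eq_zero_right h3]
      exact neg_mem hda.2
    obtain ⟨c, hc, hcb⟩ := ih k.2.le b hb h2 hb0
    rw [map_add, map_mul, hι, zero_mul, add_zero] at hw0
    have hset : x '' {j | j.val < k.val + 1} = insert (x k) (x '' {j | j.val < k.val}) := by
      rw [← Set.image_insert_eq]
      congr 1
      ext j
      simp only [Set.mem_ofPred_eq, Set.mem_insert_iff, Fin.ext_iff]
      omega
    rw [hset, Ideal.mem_span_insert] at hw0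
    obtain ⟨t, z, hz, htz⟩ := hw0
    obtain ⟨u, hu⟩ : ∃ u : R, u = -(t + ExteriorAlgebra.algebraMapInv c) := ⟨_, rfl⟩
    have hc' : c + algebraMap R _ u ∈ exteriorInitial R n k :=
      add_mem hc (algebraMap_mem_exteriorInitial u k)
    have hdc' : koszulDiff R x (c + algebraMap R _ u) = b := by
      rw [map_add, koszulDiff_algebraMap, add_zero, hcb]
    obtain ⟨v, hv, hva⟩ := ih k.2.le (a + x k • (c + algebraMap R _ u))
      (add_mem ha (Submodule.smul_mem _ _ hc')) (by rw [map_add, map_smul, hdc', h1]) (by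
        rw [map_add, map_smul, map_add, htz, ExteriorAlgebra.algebraMapInv, AlgHom.commutes,
          ← ExteriorAlgebra.algebraMapInv, hu, smul_eq_mul, Algebra.algebraMap_self_apply]
        convert hz using 1
        ring)
    refine ⟨v + ExteriorAlgebra.ι R (Pi.single k (1 : R)) * (-(c + algebraMap R _ u)),
      (mem_exteriorInitial_succ k _).2 ⟨v, hv, _, neg_mem hc', rfl⟩, ?_⟩
    rw [map_add, hva, koszulDiff_ι_single_mul, map_neg (koszulDiff R x), hdc', smul_neg, mul_neg]
    abel

end Koszul

theorem algebraMapInv_eq_zero_of_mem_exteriorPower {R M : Type*} [CommRing R] [AddCommGroup M]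
    [Module R M] {i : ℕ} (hi : 1 ≤ i) {w : ExteriorAlgebra R M} (hw : w ∈ ⋀[R]^i M) :
    ExteriorAlgebra.algebraMapInv w = 0 := by
  obtain ⟨m, rfl⟩ := Nat.exists_eq_add_of_le' hi
  have h : ⋀[R]^(m + 1) M ≤
      LinearMap.ker (ExteriorAlgebra.algebraMapInv (R := R) (M := M)).toLinearMap := by
    rw [ExteriorAlgebra.exteriorPower, pow_succ, Submodule.mul_le]
    rintro a - _ ⟨v, rfl⟩
    simp [ExteriorAlgebra.algebraMapInv]
  exact h hw

theorem finite_exteriorPower_ne_bot (R : Type*) [CommRing R] [IsNoetherianRing R] (n : ℕ) :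
    {i : ℕ | ⋀[R]^i (Fin n → R) ≠ ⊥}.Finite := by
  have : IsNoetherian R (ExteriorAlgebra R (Fin n → R)) :=
    isNoetherian_of_isNoetherianRing_of_finite R _
  exact WellFoundedGT.finite_ne_bot_of_iSupIndep
    (DirectSum.Decomposition.isInternal fun i : ℕ ↦ ⋀[R]^i (Fin n → R)).submodule_iSupIndep

/-- Let `(R, m)` be a regular local ring, `I ⊆ m` an ideal, and `K(R)`
the Koszul complex on a minimal generating sequence `x` of `m`.  Then there is `s'` such
that for all `s ≥ s'`, all `i ≥ 1` and all `j ≥ 0` one has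
`I^j ∗ H_i(R/I^s) = H_i(R/I^{s+j})`, i.e. the map
`I^j ⊗ H_i(R/I^s) → H_i(R/I^{s+j})`, `a ⊗ [u + I^s K(R)] ↦ [a u + I^{s+j} K(R)]`, is
surjective: every cycle of `K_i(R/I^{s+j})` (an element `u ∈ K_i(R) = ⋀^i R^n` with
`∂u ∈ I^{s+j} K(R)`) lies, modulo boundaries (`Im ∂ + I^{s+j} K(R)`), in
`I^j ⬝ {cycles of K_i(R/I^s)}`. -/
theorem statement14 {R : Type*} [CommRing R] [IsNoetherianRing R] [IsLocalRing R]
    (hreg : ∃ (d : ℕ) (x' : Fin d → R),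
      Ideal.span (Set.range x') = maximalIdeal R ∧ ringKrullDim R = d)
    (I : Ideal R) (hI : I ≤ maximalIdeal R)
    {n : ℕ} (x : Fin n → R) (hx : Ideal.span (Set.range x) = maximalIdeal R)
    (hxmin : ∀ i, x i ∉ Ideal.span (x '' {j | j ≠ i})) :
    ∃ s' : ℕ, ∀ s : ℕ, s' ≤ s → ∀ j i : ℕ, 1 ≤ i →
      ⋀[R]^i (Fin n → R) ⊓
          Submodule.comap (koszulDiff R x)
            (I ^ (s + j) • (⊤ : Submodule R (ExteriorAlgebra R (Fin n → R)))) ≤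
        I ^ j • (⋀[R]^i (Fin n → R) ⊓
            Submodule.comap (koszulDiff R x)
              (I ^ s • (⊤ : Submodule R (ExteriorAlgebra R (Fin n → R))))) ⊔
          LinearMap.range (koszulDiff R x) ⊔
          I ^ (s + j) • (⊤ : Submodule R (ExteriorAlgebra R (Fin n → R))) := by
  obtain ⟨d, y, hy, hd⟩ := hreg
  have hn : (n : WithBot ℕ∞) ≤ ringKrullDim R := by
    rw [hd]
    exact_mod_cast card_le_of_minimal_generators x hx hxmin y hy
  have hcolon : ∀ (k : Fin n) (r : R), x k * r ∈ Ideal.span (x '' {j | j.val < k.val}) →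
      r ∈ Ideal.span (x '' {j | j.val < k.val}) := by
    intro k r hr
    refine ((isPrime_span_image_lt x hx hn k.2.le).mem_or_mem hr).resolve_left fun h ↦ ?_
    refine hxmin k (Ideal.span_mono (Set.image_mono fun j hj ↦ ?_) h)
    rintro rfl
    exact lt_irrefl j.val hj
  choose K hK using fun i : ℕ ↦
    Ideal.exists_pow_inf_eq_pow_smul I ((⋀[R]^i (Fin n → R)).map (koszulDiff R x))
  refine ⟨(finite_exteriorPower_ne_bot R n).toFinset.sup K, fun s hs j i hi z hz ↦ ?_⟩
  by_cases hbot : ⋀[R]^i (Fin n → R) = ⊥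
  · have hz0 : z = 0 := by simpa [hbot] using hz.1
    rw [hz0]
    exact zero_mem _
  have hKs : K i ≤ s := (Finset.le_sup (by simpa using hbot)).trans hs
  refine Submodule.mem_sup_left ?_
  set C := ⋀[R]^i (Fin n → R) ⊓ Submodule.comap (koszulDiff R x)
    (I ^ s • (⊤ : Submodule R (ExteriorAlgebra R (Fin n → R)))) with hC
  have hmem : koszulDiff R x z ∈ (I ^ j • C).map (koszulDiff R x) := by
    have h1 : koszulDiff R x z ∈
        I ^ (s + j) • ⊤ ⊓ (⋀[R]^i (Fin n → R)).map (koszulDiff R x) :=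
      ⟨hz.2, Submodule.mem_map_of_mem hz.1⟩
    rw [hK i (s + j) (by omega), show s + j - K i = j + (s - K i) by omega, pow_add, mul_smul,
      ← hK i s hKs] at h1
    rw [Submodule.map_smul'']
    refine Submodule.smul_mono le_rfl ?_ h1
    rintro _ ⟨hw, u, hu, rfl⟩
    exact Submodule.mem_map_of_mem ⟨hu, hw⟩
  obtain ⟨u, hu, huz⟩ := hmem
  have hsub : z - u ∈ ⋀[R]^i (Fin n → R) :=
    sub_mem hz.1 (Submodule.smul_le_right hu : u ∈ C).1
  obtain ⟨v, -, hv⟩ := exists_koszulDiff_eq x hcolon n le_rfl (z - u)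
    (exteriorInitial_eq_top (R := R) (n := n) ▸ Submodule.mem_top)
    (by rw [map_sub, huz, sub_self])
    (by rw [algebraMapInv_eq_zero_of_mem_exteriorPower hi hsub]; exact zero_mem _)
  exact Submodule.mem_sup.2 ⟨u, hu, z - u, ⟨v, hv⟩, add_sub_cancel _ _⟩
end
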